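/- Let p1, p2 be probability mass functions on {0,1}×𝒴1 and {0,1}×𝒴2 respectively, let q be their combined distribution, and let α∈(0,1/3]∪[1/2,1)∪(1,∞). Set δ = 2^{(α−1)/α} and K_i = exp(((α−1)/α)·H^A_α(X_i|Y_i)_{p_i}) for i=1,2. Then H^A_α(X_2|(X_1⊕X_2)Y_1Y_2)_q ≥ H^A_α(X_1|Y_1)_{p_1} + H^A_α(X_2|Y_2)_{p_2} − (α/(α−1))·log[ (δ−K_1)(δ−K_2)/(1−δ) + δ ]. For α∈[1/3,1/2] the same holds with ≥ replaced by ≤, and for α∈{1/3,1/2} it holds with equality. -/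

import Mathlib

open Finset

/-- `p` is a probability mass function on a finite type. -/
def IsPMF {Ω : Type*} [Fintype Ω] (p : Ω → ℝ) : Prop :=
  (∀ ω, 0 ≤ p ω) ∧ ∑ ω, p ω = 1

/-- Marginal distribution of the second component. -/
noncomputable def margY {X Y : Type*} [Fintype X] (p : X × Y → ℝ) (y : Y) : ℝ := ∑ x, p (x, y)

/-- Conditional distribution `p(x|y)`. -/
noncomputable def condXY {X Y : Type*} [Fintype X] (p : X × Y → ℝ) (x : X) (y : Y) : ℝ :=
  p (x, y) / margY p y

/-- Hayashi conditional Rényi entropy `H^H_α(X|Y)_p`. -/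
noncomputable def HH {X Y : Type*} [Fintype X] [Fintype Y] (α : ℝ) (p : X × Y → ℝ) : ℝ :=
  (1 / (1 - α)) * Real.log (∑ y, margY p y * ∑ x, condXY p x y ^ α)

/-- Arimoto conditional Rényi entropy `H^A_α(X|Y)_p`. -/
noncomputable def HA {X Y : Type*} [Fintype X] [Fintype Y] (α : ℝ) (p : X × Y → ℝ) : ℝ :=
  (α / (1 - α)) * Real.log (∑ y, margY p y * (∑ x, condXY p x y ^ α) ^ (1 / α))

/-- The tilted probability mass function `p̄`. -/
noncomputable def tilt {X Y : Type*} [Fintype X] [Fintype Y] (α : ℝ) (p : X × Y → ℝ) :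
    X × Y → ℝ := fun (x, y) =>
  condXY p x y ^ α * margY p y / ∑ xy : X × Y, condXY p xy.1 xy.2 ^ α * margY p xy.2

variable {Y1 Y2 : Type*} [Fintype Y1] [Fintype Y2]

/-- The joint distribution of `Z = X₁ ⊕ X₂` and the side information `(Y₁, Y₂)` under the
combined distribution `q(z,x₂,y₁,y₂) = p₁(z ⊕ x₂, y₁) p₂(x₂, y₂)`. -/
noncomputable def combinedZ (p1 : ZMod 2 × Y1 → ℝ) (p2 : ZMod 2 × Y2 → ℝ) :
    ZMod 2 × (Y1 × Y2) → ℝ := fun zy => ∑ x2 : ZMod 2, p1 (zy.1 + x2, zy.2.1) * p2 (x2, zy.2.2)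

/-- The joint distribution of `X₂` and `(Z = X₁ ⊕ X₂, Y₁, Y₂)` under the combined
distribution `q(z,x₂,y₁,y₂) = p₁(z ⊕ x₂, y₁) p₂(x₂, y₂)`. -/
noncomputable def combinedX2 (p1 : ZMod 2 × Y1 → ℝ) (p2 : ZMod 2 × Y2 → ℝ) :
    ZMod 2 × (ZMod 2 × Y1 × Y2) → ℝ := fun xw =>
  p1 (xw.2.1 + xw.1, xw.2.2.1) * p2 (xw.1, xw.2.2.2)

/-- A function with nonnegative derivative on `[a, b]` satisfies `f a ≤ f b`. -/
theorem le_of_hasDerivAt_nonneg {f f' : ℝ → ℝ} {a b : ℝ} (hab : a ≤ b)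
    (hf : ∀ x ∈ Set.Icc a b, HasDerivAt f (f' x) x) (hf' : ∀ x ∈ Set.Icc a b, 0 ≤ f' x) :
    f a ≤ f b := by
  refine monotoneOn_of_deriv_nonneg (convex_Icc a b)
    (fun x hx => (hf x hx).continuousAt.continuousWithinAt)
    (fun x hx => (hf x (interior_subset hx)).differentiableAt.differentiableWithinAt)
    (fun x hx => ?_) (Set.left_mem_Icc.2 hab) (Set.right_mem_Icc.2 hab) hab
  rw [(hf x (interior_subset hx)).deriv]
  exact hf' x (interior_subset hx)

theorem hasDerivAt_rpow_of_pos {x : ℝ} (hx : 0 < x) (p : ℝ) :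
    HasDerivAt (fun y : ℝ => y ^ p) (p * x ^ (p - 1)) x :=
  Real.hasDerivAt_rpow_const (Or.inl hx.ne')

theorem hasDerivAt_add_one_rpow_of_pos {x : ℝ} (hx : 0 < x + 1) (p : ℝ) :
    HasDerivAt (fun y : ℝ => (y + 1) ^ p) (p * (x + 1) ^ (p - 1)) x := by
  simpa using ((hasDerivAt_id x).add_const (1 : ℝ)).rpow_const (p := p) (Or.inl hx.ne')

theorem rpow_sub_one_mul_self {y : ℝ} (hy : 0 < y) (p : ℝ) : y ^ (p - 1) * y = y ^ p := by
  rw [Real.rpow_sub_one hy.ne', div_mul_cancel₀ _ hy.ne']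

/-- Sign of the function governing the second derivative in `mul_erasureKernel_nonneg`. -/
theorem mul_erasureCurvature_nonneg (β : ℝ) {y : ℝ} (hy : 1 ≤ y) (hy2 : y ≤ 2) :
    0 ≤ ((β - 1) * (β - 2) * (β - 3)) * ((3 - β) * y ^ (β - 1) + 2 * (β - 1) * y ^ (β - 2)
      - (β - 1) ^ 2 * y - β * (3 - β)) := by
  set s := (β - 1) * (β - 2) * (β - 3) with hs
  have slope : ∀ x ∈ Set.Icc 1 y, 0 ≤ s * ((β - 1) * ((3 - β) * x ^ (β - 2)
      + 2 * (β - 2) * x ^ (β - 3) - (β - 1))) := by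
    intro x hx
    have := le_of_hasDerivAt_nonneg (a := 1) (b := x) hx.1
      (f := fun x => s * ((β - 1) * ((3 - β) * x ^ (β - 2) + 2 * (β - 2) * x ^ (β - 3) - (β - 1))))
      (f' := fun x => s ^ 2 * (x ^ (β - 4) * (2 - x))) ?_ ?_
    · norm_num at this
      linarith
    · intro w hw
      have hw0 : 0 < w := by linarith [hw.1]
      have key := (((((hasDerivAt_rpow_of_pos hw0 (β - 2)).const_mul (3 - β)).add
        ((hasDerivAt_rpow_of_pos hw0 (β - 3)).const_mul (2 * (β - 2)))).sub_const
          (β - 1)).const_mul (β - 1)).const_mul s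
      refine key.congr_deriv ?_
      rw [show β - 2 - 1 = β - 3 by ring, ← rpow_sub_one_mul_self hw0 (β - 3),
        show β - 3 - 1 = β - 4 by ring, hs]
      ring
    · intro w hw
      have hw0 : 0 < w := by linarith [hw.1]
      have : 0 ≤ 2 - w := by linarith [hw.2, hx.2]
      positivity
  have := le_of_hasDerivAt_nonneg (a := 1) (b := y) hy
    (f := fun x => s * ((3 - β) * x ^ (β - 1) + 2 * (β - 1) * x ^ (β - 2)
      - (β - 1) ^ 2 * x - β * (3 - β)))
    (f' := fun x => s * ((β - 1) * ((3 - β) * x ^ (β - 2)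
      + 2 * (β - 2) * x ^ (β - 3) - (β - 1)))) ?_ slope
  · norm_num at this
    refine le_trans (le_of_eq ?_) this
    ring
  · intro w hw
    have hw0 : 0 < w := by linarith [hw.1]
    have key := (((((hasDerivAt_rpow_of_pos hw0 (β - 1)).const_mul (3 - β)).add
      ((hasDerivAt_rpow_of_pos hw0 (β - 2)).const_mul (2 * (β - 1)))).sub
        ((hasDerivAt_id w).const_mul ((β - 1) ^ 2))).sub_const (β * (3 - β))).const_mul s
    refine key.congr_deriv ?_
    rw [show β - 2 - 1 = β - 3 by ring, show β - 1 - 1 = β - 2 by ring]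
    ring

theorem mul_erasureKernel_nonneg {β : ℝ} (hβ : 0 < β) {z : ℝ} (hz : 1 ≤ z) :
    0 ≤ ((β - 1) * (β - 2) * (β - 3)) * ((z - 1) * (z + 1) ^ β - z ^ (β + 1)
      + (1 - β) * z ^ β - (1 - β) * z + 1) := by
  set s := (β - 1) * (β - 2) * (β - 3) with hs
  have slope : ∀ x ∈ Set.Icc 1 z, 0 ≤ s * ((x + 1) ^ β + β * ((x - 1) * (x + 1) ^ (β - 1))
      - (β + 1) * x ^ β + (1 - β) * (β * x ^ (β - 1)) - (1 - β)) := by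
    intro x hx
    have := le_of_hasDerivAt_nonneg (a := 1) (b := x) hx.1
      (f := fun x => s * ((x + 1) ^ β + β * ((x - 1) * (x + 1) ^ (β - 1))
        - (β + 1) * x ^ β + (1 - β) * (β * x ^ (β - 1)) - (1 - β)))
      (f' := fun x => β * x ^ (β - 1) * (s * ((3 - β) * ((x + 1) / x) ^ (β - 1)
        + 2 * (β - 1) * ((x + 1) / x) ^ (β - 2) - (β - 1) ^ 2 * ((x + 1) / x) - β * (3 - β)))) ?_ ?_
    · have two := mul_erasureCurvature_nonneg β (y := 2) (by norm_num) le_rfl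
      have h2 := rpow_sub_one_mul_self (two_pos (α := ℝ)) β
      have h1 := rpow_sub_one_mul_self (two_pos (α := ℝ)) (β - 1)
      rw [show β - 1 - 1 = β - 2 by ring] at h1
      rw [← hs, ← h1] at two
      refine le_trans two (le_trans (le_of_eq ?_) this)
      rw [Real.one_rpow, Real.one_rpow, one_add_one_eq_two, ← h2, ← h1]
      ring
    · intro w hw
      have hw0 : 0 < w := by linarith [hw.1]
      have hw1 : 0 < w + 1 := by linarith
      have key := ((((((hasDerivAt_add_one_rpow_of_pos hw1 β).add
        ((((hasDerivAt_id w).sub_const 1).mul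
          (hasDerivAt_add_one_rpow_of_pos hw1 (β - 1))).const_mul β)).sub
        ((hasDerivAt_rpow_of_pos hw0 β).const_mul (β + 1))).add
        (((hasDerivAt_rpow_of_pos hw0 (β - 1)).const_mul β).const_mul (1 - β))).sub_const
          (1 - β)).const_mul s)
      refine key.congr_deriv ?_
      have e1 := rpow_sub_one_mul_self hw1 (β - 1)
      have e2 := rpow_sub_one_mul_self hw0 (β - 1)
      rw [show β - 1 - 1 = β - 2 by ring] at e1 e2 ⊢
      rw [Real.div_rpow hw1.le hw0.le, Real.div_rpow hw1.le hw0.le, ← e1, ← e2]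
      have := (Real.rpow_pos_of_pos hw0 (β - 2)).ne'
      simp only [id]
      field_simp
      ring
    · intro w hw
      have hw0 : 0 < w := by linarith [hw.1]
      have := mul_erasureCurvature_nonneg β (y := (w + 1) / w) (by rw [le_div_iff₀ hw0]; linarith)
        (by rw [div_le_iff₀ hw0]; linarith [hw.1])
      positivity
  have := le_of_hasDerivAt_nonneg (a := 1) (b := z) hz
    (f := fun z => s * ((z - 1) * (z + 1) ^ β - z ^ (β + 1)
      + (1 - β) * z ^ β - (1 - β) * z + 1))
    (f' := fun x => s * ((x + 1) ^ β + β * ((x - 1) * (x + 1) ^ (β - 1))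
      - (β + 1) * x ^ β + (1 - β) * (β * x ^ (β - 1)) - (1 - β))) ?_ slope
  · norm_num at this
    exact this
  · intro w hw
    have hw0 : 0 < w := by linarith [hw.1]
    have hw1 : 0 < w + 1 := by linarith
    have key := (((((((hasDerivAt_id w).sub_const 1).mul
      (hasDerivAt_add_one_rpow_of_pos hw1 β)).sub (hasDerivAt_rpow_of_pos hw0 (β + 1))).add
      ((hasDerivAt_rpow_of_pos hw0 β).const_mul (1 - β))).sub
      ((hasDerivAt_id w).const_mul (1 - β))).add_const 1).const_mul s
    refine key.congr_deriv ?_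
    rw [show β + 1 - 1 = β by ring]
    simp only [id]
    ring

/-- The even function `(2 cosh u)^β - 2 cosh (β u)`. -/
noncomputable def coshGap (β u : ℝ) : ℝ := (2 * Real.cosh u) ^ β - 2 * Real.cosh (β * u)

/-- The derivative of `coshGap β`. -/
noncomputable def coshGapDeriv (β u : ℝ) : ℝ :=
  β * (2 * Real.cosh u) ^ (β - 1) * (2 * Real.sinh u) - 2 * β * Real.sinh (β * u)

theorem two_mul_cosh_pos (u : ℝ) : 0 < 2 * Real.cosh u := by
  have := Real.cosh_pos u
  positivity

theorem hasDerivAt_two_mul_cosh_rpow (p u : ℝ) :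
    HasDerivAt (fun u => (2 * Real.cosh u) ^ p)
      (p * (2 * Real.cosh u) ^ (p - 1) * (2 * Real.sinh u)) u := by
  refine (((Real.hasDerivAt_cosh u).const_mul 2).rpow_const (p := p)
    (Or.inl (two_mul_cosh_pos u).ne')).congr_deriv ?_
  ring

theorem hasDerivAt_mul_left (β u : ℝ) : HasDerivAt (fun u => β * u) β u := by
  simpa using (hasDerivAt_id u).const_mul β

theorem hasDerivAt_coshGap (β u : ℝ) : HasDerivAt (coshGap β) (coshGapDeriv β u) u := by
  refine ((hasDerivAt_two_mul_cosh_rpow β u).sub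
    (((hasDerivAt_mul_left β u).cosh).const_mul 2)).congr_deriv ?_
  rw [coshGapDeriv]
  ring

theorem hasDerivAt_coshGapDeriv (β u : ℝ) : HasDerivAt (coshGapDeriv β)
    (β ^ 2 * coshGap β u - 4 * β * (β - 1) * (2 * Real.cosh u) ^ (β - 2)) u := by
  refine ((((hasDerivAt_two_mul_cosh_rpow (β - 1) u).const_mul β).mul
    ((Real.hasDerivAt_sinh u).const_mul 2)).sub
    (((hasDerivAt_mul_left β u).sinh).const_mul (2 * β))).congr_deriv ?_
  have hC := two_mul_cosh_pos u
  have e0 := rpow_sub_one_mul_self hC β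
  have e1 := rpow_sub_one_mul_self hC (β - 1)
  rw [show β - 1 - 1 = β - 2 by ring] at e1
  rw [coshGap, show β - 1 - 1 = β - 2 by ring, ← e0, ← e1]
  linear_combination (-4 * β * (β - 1) * (2 * Real.cosh u) ^ (β - 2)) * Real.cosh_sq u

theorem coshGap_neg (β u : ℝ) : coshGap β (-u) = coshGap β u := by
  simp [coshGap]

theorem coshGap_mul_rpow_mono {β : ℝ} (hβ : 0 < β) {u v : ℝ} (hv : 0 ≤ v) (hvu : v ≤ u) :
    ((β - 1) * (β - 2) * (β - 3)) * (coshGap β v * (2 * Real.cosh v) ^ (2 - β)) ≤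
      ((β - 1) * (β - 2) * (β - 3)) * (coshGap β u * (2 * Real.cosh u) ^ (2 - β)) := by
  set s := (β - 1) * (β - 2) * (β - 3) with hs
  refine le_of_hasDerivAt_nonneg hvu
    (f := fun u => s * (coshGap β u * (2 * Real.cosh u) ^ (2 - β)))
    (f' := fun u => 2 * (2 * Real.cosh u) ^ (1 - β) * Real.exp (-((β + 1) * u)) *
      (s * ((Real.exp (2 * u) - 1) * (Real.exp (2 * u) + 1) ^ β - Real.exp (2 * u) ^ (β + 1)
      + (1 - β) * Real.exp (2 * u) ^ β - (1 - β) * Real.exp (2 * u) + 1))) ?_ ?_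
  · intro u _
    refine (((hasDerivAt_coshGap β u).mul
      (hasDerivAt_two_mul_cosh_rpow (2 - β) u)).const_mul s).congr_deriv ?_
    have hC := two_mul_cosh_pos u
    have e0 := rpow_sub_one_mul_self hC β
    have e1 := rpow_sub_one_mul_self hC (2 - β)
    rw [show 2 - β - 1 = 1 - β by ring] at e1 ⊢
    have hA := Real.exp_pos u
    have hB := Real.exp_pos (β * u)
    have z1 : Real.exp (2 * u) = Real.exp u ^ 2 := by rw [← Real.exp_nat_mul]; norm_num
    have z2 : Real.exp (2 * u) ^ β = Real.exp (β * u) ^ 2 := by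
      rw [← Real.exp_mul, ← Real.exp_nat_mul]; congr 1; push_cast; ring
    have z3 : Real.exp (2 * u) ^ (β + 1) = Real.exp (β * u) ^ 2 * Real.exp u ^ 2 := by
      rw [Real.rpow_add_one (Real.exp_pos _).ne', z2, z1]
    have z4 : Real.exp (-((β + 1) * u)) = (Real.exp (β * u) * Real.exp u)⁻¹ := by
      rw [← Real.exp_add, ← Real.exp_neg]; congr 1; ring
    have z5 : (Real.exp (2 * u) + 1) ^ β = Real.exp (β * u) * (2 * Real.cosh u) ^ β := by
      rw [mul_comm β u, Real.exp_mul u β, ← Real.mul_rpow hA.le hC.le, z1, Real.cosh_eq,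
        Real.exp_neg]
      congr 1
      field_simp
    have hc : Real.cosh u = (Real.exp u + (Real.exp u)⁻¹) / 2 := by
      rw [Real.cosh_eq, Real.exp_neg]
    have hc' : Real.cosh (β * u) = (Real.exp (β * u) + (Real.exp (β * u))⁻¹) / 2 := by
      rw [Real.cosh_eq, Real.exp_neg]
    have hd : Real.sinh u = (Real.exp u - (Real.exp u)⁻¹) / 2 := by
      rw [Real.sinh_eq, Real.exp_neg]
    have hd' : Real.sinh (β * u) = (Real.exp (β * u) - (Real.exp (β * u))⁻¹) / 2 := by
      rw [Real.sinh_eq, Real.exp_neg]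
    rw [z5, z3, z2, z4, z1, ← e1, coshGap, coshGapDeriv]
    have step : s * ((β * (2 * Real.cosh u) ^ (β - 1) * (2 * Real.sinh u)
        - 2 * β * Real.sinh (β * u)) * ((2 * Real.cosh u) ^ (1 - β) * (2 * Real.cosh u)) +
        ((2 * Real.cosh u) ^ β - 2 * Real.cosh (β * u)) *
          ((2 - β) * (2 * Real.cosh u) ^ (1 - β) * (2 * Real.sinh u))) =
        s * (2 * Real.cosh u) ^ (1 - β) * (β * (2 * Real.cosh u) ^ β * (2 * Real.sinh u)
          - 2 * β * Real.sinh (β * u) * (2 * Real.cosh u) +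
        ((2 * Real.cosh u) ^ β - 2 * Real.cosh (β * u)) * ((2 - β) * (2 * Real.sinh u))) := by
      rw [← e0]; ring
    rw [step]
    generalize (2 * Real.cosh u) ^ (1 - β) = K1
    generalize (2 * Real.cosh u) ^ β = K
    rw [hc, hc', hd, hd']
    generalize Real.exp u = A at *
    generalize Real.exp (β * u) = B at *
    field_simp
    ring
  · intro u hu
    have := mul_erasureKernel_nonneg hβ (z := Real.exp (2 * u))
      (Real.one_le_exp (by linarith [hu.1]))
    have hC := two_mul_cosh_pos u
    positivity

/-- The Wronskian derivative of two translates of `coshGap β` has constant sign. -/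
theorem coshGap_wronskian_nonneg {β : ℝ} (hβ : 0 < β) {u v : ℝ} (hv : 0 ≤ v) (hvu : v ≤ u) :
    0 ≤ ((β - 2) * (β - 3)) * ((β - 1) * (coshGap β u * (2 * Real.cosh v) ^ (β - 2)
      - coshGap β v * (2 * Real.cosh u) ^ (β - 2))) := by
  have h := coshGap_mul_rpow_mono hβ hv hvu
  have hU := two_mul_cosh_pos u
  have hV := two_mul_cosh_pos v
  have pU := Real.rpow_pos_of_pos hU (β - 2)
  have pV := Real.rpow_pos_of_pos hV (β - 2)
  rw [show 2 - β = -(β - 2) by ring, Real.rpow_neg hU.le, Real.rpow_neg hV.le] at h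
  have := mul_le_mul_of_nonneg_left h (mul_pos pU pV).le
  rw [← sub_nonneg] at this
  refine this.trans_eq ?_
  field_simp

theorem coshGapDeriv_mul_le {β : ℝ} (hβ : 0 < β) {u v : ℝ} (hv : 0 ≤ v) (hvu : v ≤ u) :
    0 ≤ ((β - 2) * (β - 3)) * (coshGap β 0 * coshGapDeriv β (u + v)
      - (coshGapDeriv β u * coshGap β v + coshGap β u * coshGapDeriv β v)) := by
  set k := (β - 2) * (β - 3) with hk
  have := le_of_hasDerivAt_nonneg hv
    (f := fun t => k * (coshGap β 0 * coshGapDeriv β (u + v)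
      - (coshGapDeriv β (u + v - t) * coshGap β t + coshGap β (u + v - t) * coshGapDeriv β t)))
    (f' := fun t => 4 * β * (k * ((β - 1) * (coshGap β (u + v - t) * (2 * Real.cosh t) ^ (β - 2)
      - coshGap β t * (2 * Real.cosh (u + v - t)) ^ (β - 2))))) ?_ ?_
  · have h0 : coshGapDeriv β 0 = 0 := by simp [coshGapDeriv]
    simp only [sub_zero, add_sub_cancel_right, h0] at this
    refine le_trans (le_of_eq ?_) this
    ring
  · intro t _
    have d : HasDerivAt (fun t => u + v - t) (-1) t := by
      simpa using (hasDerivAt_id t).const_sub (u + v)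
    have a1 := (hasDerivAt_coshGapDeriv β (u + v - t)).comp t d
    have a2 := (hasDerivAt_coshGap β (u + v - t)).comp t d
    refine ((((a1.mul (hasDerivAt_coshGap β t)).add
      (a2.mul (hasDerivAt_coshGapDeriv β t))).const_sub
        (coshGap β 0 * coshGapDeriv β (u + v))).const_mul k).congr_deriv ?_
    simp only [Function.comp]
    ring
  · intro t ht
    have := coshGap_wronskian_nonneg hβ ht.1 (u := u + v - t) (by linarith [ht.2])
    positivity

theorem coshGap_dAlembert_of_le {β : ℝ} (hβ : 0 < β) {u v : ℝ} (hv : 0 ≤ v) (hvu : v ≤ u) :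
    0 ≤ ((β - 2) * (β - 3)) * (coshGap β 0 * (coshGap β (u + v) + coshGap β (u - v))
      - 2 * (coshGap β u * coshGap β v)) := by
  set k := (β - 2) * (β - 3) with hk
  have := le_of_hasDerivAt_nonneg hv
    (f := fun t => k * (coshGap β 0 * (coshGap β (u - v + 2 * t) + coshGap β (u - v))
      - 2 * (coshGap β (u - v + t) * coshGap β t)))
    (f' := fun t => 2 * (k * (coshGap β 0 * coshGapDeriv β (u - v + t + t)
      - (coshGapDeriv β (u - v + t) * coshGap β t + coshGap β (u - v + t) * coshGapDeriv β t))))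
      ?_ ?_
  · rw [show u - v + 2 * v = u + v by ring, show u - v + v = u by ring] at this
    refine le_trans (le_of_eq ?_) this
    simp only [mul_zero, add_zero]
    ring
  · intro t _
    have d : HasDerivAt (fun t => u - v + t) 1 t := by
      simpa using (hasDerivAt_id t).const_add (u - v)
    have d2 : HasDerivAt (fun t => u - v + 2 * t) 2 t :=
      (hasDerivAt_mul_left 2 t).const_add (u - v)
    have a1 := (hasDerivAt_coshGap β (u - v + 2 * t)).comp t d2
    have a2 := (hasDerivAt_coshGap β (u - v + t)).comp t d
    refine (((((a1.add_const (coshGap β (u - v))).const_mul (coshGap β 0)).sub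
      ((a2.mul (hasDerivAt_coshGap β t)).const_mul 2))).const_mul k).congr_deriv ?_
    simp only [Function.comp]
    rw [show u - v + t + t = u - v + 2 * t by ring]
    ring
  · intro t ht
    have := coshGapDeriv_mul_le hβ ht.1 (u := u - v + t) (by linarith)
    positivity

/-- A d'Alembert type functional inequality for `coshGap`. -/
theorem coshGap_dAlembert {β : ℝ} (hβ : 0 < β) (u v : ℝ) :
    0 ≤ ((β - 2) * (β - 3)) * (coshGap β 0 * (coshGap β (u + v) + coshGap β (u - v))
      - 2 * (coshGap β u * coshGap β v)) := by
  wlog hv : 0 ≤ v generalizing v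
  · have := this (-v) (by linarith)
    rw [coshGap_neg, ← sub_eq_add_neg, sub_neg_eq_add] at this
    refine this.trans_eq ?_
    ring
  wlog hu : 0 ≤ u generalizing u
  · have := this (-u) (by linarith)
    rw [coshGap_neg, show -u + v = -(u - v) by ring, show -u - v = -(u + v) by ring, coshGap_neg,
      coshGap_neg] at this
    refine this.trans_eq ?_
    ring
  rcases le_total v u with h | h
  · exact coshGap_dAlembert_of_le hβ hv h
  · have := coshGap_dAlembert_of_le hβ hu h
    rw [← neg_sub u v, coshGap_neg, add_comm v u] at this
    refine this.trans_eq ?_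
    ring

/-- The additivity defect of `x ↦ x ^ β`. -/
noncomputable def rpowGap (β a b : ℝ) : ℝ := (a + b) ^ β - a ^ β - b ^ β

/-- The two-variable defect whose sign decides the comparison with the erasure channel. -/
noncomputable def combineGap (β a b c d : ℝ) : ℝ :=
  (2 ^ β - 2) * (rpowGap β (a * c) (b * d) + rpowGap β (b * c) (a * d))
    - 2 * (rpowGap β a b * rpowGap β c d)

theorem rpowGap_comm (β a b : ℝ) : rpowGap β a b = rpowGap β b a := by
  rw [rpowGap, rpowGap, add_comm a b]; ring

theorem rpowGap_zero_left {β : ℝ} (hβ : 0 < β) (b : ℝ) : rpowGap β 0 b = 0 := by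
  simp [rpowGap, Real.zero_rpow hβ.ne']

theorem rpowGap_zero_right {β : ℝ} (hβ : 0 < β) (a : ℝ) : rpowGap β a 0 = 0 := by
  rw [rpowGap_comm, rpowGap_zero_left hβ]

theorem rpowGap_exp (β p u : ℝ) :
    rpowGap β (Real.exp (p + u)) (Real.exp (p - u)) = Real.exp (β * p) * coshGap β u := by
  have h : Real.exp (p + u) + Real.exp (p - u) = Real.exp p * (2 * Real.cosh u) := by
    rw [Real.cosh_eq, sub_eq_add_neg, Real.exp_add, Real.exp_add]; ring
  have h' : Real.exp (β * u) + Real.exp (-(β * u)) = 2 * Real.cosh (β * u) := by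
    rw [Real.cosh_eq]; ring
  rw [rpowGap, h, Real.mul_rpow (Real.exp_pos p).le (two_mul_cosh_pos u).le, ← Real.exp_mul,
    ← Real.exp_mul, ← Real.exp_mul, coshGap, ← h', show (p + u) * β = β * p + β * u by ring,
    show (p - u) * β = β * p + -(β * u) by ring, Real.exp_add, Real.exp_add, mul_comm p β]
  ring

theorem combineGap_exp (β p q u v : ℝ) :
    combineGap β (Real.exp (p + u)) (Real.exp (p - u)) (Real.exp (q + v)) (Real.exp (q - v)) =
      Real.exp (β * (p + q)) * (coshGap β 0 * (coshGap β (u + v) + coshGap β (u - v))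
        - 2 * (coshGap β u * coshGap β v)) := by
  have h0 : coshGap β 0 = 2 ^ β - 2 := by simp [coshGap]
  rw [combineGap, rpowGap_comm β (Real.exp (p - u) * _)]
  simp only [← Real.exp_add]
  rw [show p + u + (q + v) = (p + q) + (u + v) by ring,
    show p - u + (q - v) = (p + q) - (u + v) by ring,
    show p + u + (q - v) = (p + q) + (u - v) by ring,
    show p - u + (q + v) = (p + q) - (u - v) by ring]
  simp only [rpowGap_exp, h0]
  rw [mul_add β p q, Real.exp_add]
  ring

theorem exists_eq_exp_add_sub {a b : ℝ} (ha : 0 < a) (hb : 0 < b) :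
    ∃ p u : ℝ, a = Real.exp (p + u) ∧ b = Real.exp (p - u) := by
  refine ⟨(Real.log a + Real.log b) / 2, (Real.log a - Real.log b) / 2, ?_, ?_⟩
  · rw [← add_div, show Real.log a + Real.log b + (Real.log a - Real.log b) = Real.log a * 2 by ring,
      mul_div_cancel_right₀ _ two_ne_zero, Real.exp_log ha]
  · rw [← sub_div, show Real.log a + Real.log b - (Real.log a - Real.log b) = Real.log b * 2 by ring,
      mul_div_cancel_right₀ _ two_ne_zero, Real.exp_log hb]

theorem mul_combineGap_nonneg {β : ℝ} (hβ : 0 < β) {a b c d : ℝ} (ha : 0 ≤ a) (hb : 0 ≤ b)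
    (hc : 0 ≤ c) (hd : 0 ≤ d) : 0 ≤ ((β - 2) * (β - 3)) * combineGap β a b c d := by
  rcases ha.eq_or_lt with rfl | ha
  · simp [combineGap, rpowGap_zero_left hβ, rpowGap_zero_right hβ]
  rcases hb.eq_or_lt with rfl | hb
  · simp [combineGap, rpowGap_zero_left hβ, rpowGap_zero_right hβ]
  rcases hc.eq_or_lt with rfl | hc
  · simp [combineGap, rpowGap_zero_left hβ]
  rcases hd.eq_or_lt with rfl | hd
  · simp [combineGap, rpowGap_zero_right hβ]
  obtain ⟨p, u, rfl, rfl⟩ := exists_eq_exp_add_sub ha hb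
  obtain ⟨q, v, rfl, rfl⟩ := exists_eq_exp_add_sub hc hd
  have := coshGap_dAlembert hβ u v
  rw [combineGap_exp, mul_left_comm]
  positivity

theorem combineGap_two (a b c d : ℝ) : combineGap 2 a b c d = 0 := by
  simp only [combineGap, rpowGap, Real.rpow_two]
  ring

theorem combineGap_three (a b c d : ℝ) : combineGap 3 a b c d = 0 := by
  have h (x : ℝ) : x ^ (3 : ℝ) = x ^ 3 := by exact_mod_cast Real.rpow_natCast x 3
  simp only [combineGap, rpowGap, h]
  ring

theorem combineGap_nonneg {β : ℝ} (hβ : 0 < β) (hk : 0 ≤ (β - 2) * (β - 3)) {a b c d : ℝ}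
    (ha : 0 ≤ a) (hb : 0 ≤ b) (hc : 0 ≤ c) (hd : 0 ≤ d) : 0 ≤ combineGap β a b c d := by
  rcases hk.eq_or_lt with hk | hk
  · rcases mul_eq_zero.1 hk.symm with h | h
    · rw [sub_eq_zero.1 h, combineGap_two]
    · rw [sub_eq_zero.1 h, combineGap_three]
  · exact nonneg_of_mul_nonneg_right (mul_combineGap_nonneg hβ ha hb hc hd) hk

theorem combineGap_nonpos {β : ℝ} (hβ : 0 < β) (hk : (β - 2) * (β - 3) ≤ 0) {a b c d : ℝ}
    (ha : 0 ≤ a) (hb : 0 ≤ b) (hc : 0 ≤ c) (hd : 0 ≤ d) : combineGap β a b c d ≤ 0 := by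
  rcases hk.eq_or_lt with hk | hk
  · rcases mul_eq_zero.1 hk with h | h
    · rw [sub_eq_zero.1 h, combineGap_two]
    · rw [sub_eq_zero.1 h, combineGap_three]
  · exact nonpos_of_mul_nonneg_right (mul_combineGap_nonneg hβ ha hb hc hd) hk

/-- The sum over `y` of the `α`-norms of `p(·, y)`. -/
noncomputable def arimotoSum {X Y : Type*} [Fintype X] [Fintype Y] (α : ℝ) (p : X × Y → ℝ) : ℝ :=
  ∑ y, (∑ x, p (x, y) ^ α) ^ (1 / α)

theorem margY_mul_rpow_sum_condXY {X Y : Type*} [Fintype X] {α : ℝ} (hα : 0 < α)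
    {p : X × Y → ℝ} (hp : ∀ ω, 0 ≤ p ω) (y : Y) :
    margY p y * (∑ x, condXY p x y ^ α) ^ (1 / α) = (∑ x, p (x, y) ^ α) ^ (1 / α) := by
  have hm : 0 ≤ margY p y := Finset.sum_nonneg fun x _ => hp _
  rcases hm.eq_or_lt with h | h
  · have h0 : ∀ x, p (x, y) = 0 := fun x =>
      (Finset.sum_eq_zero_iff_of_nonneg fun x _ => hp (x, y)).1 h.symm x (Finset.mem_univ x)
    simp [← h, h0, Real.zero_rpow hα.ne', Real.zero_rpow (inv_ne_zero hα.ne')]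
  · have h1 : ∑ x, condXY p x y ^ α = (∑ x, p (x, y) ^ α) / margY p y ^ α := by
      rw [Finset.sum_div]
      exact Finset.sum_congr rfl fun x _ => Real.div_rpow (hp _) hm α
    rw [h1, Real.div_rpow (Finset.sum_nonneg fun x _ => Real.rpow_nonneg (hp _) _)
      (Real.rpow_nonneg hm _), ← Real.rpow_mul hm, mul_one_div_cancel hα.ne', Real.rpow_one,
      mul_div_cancel₀ _ h.ne']

theorem HA_eq_log_arimotoSum {X Y : Type*} [Fintype X] [Fintype Y] {α : ℝ} (hα : 0 < α)
    {p : X × Y → ℝ} (hp : ∀ ω, 0 ≤ p ω) :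
    HA α p = (α / (1 - α)) * Real.log (arimotoSum α p) := by
  simp only [HA, arimotoSum, margY_mul_rpow_sum_condXY hα hp]

theorem arimotoSum_pos {X Y : Type*} [Fintype X] [Fintype Y] (α : ℝ)
    {p : X × Y → ℝ} (hp : ∀ ω, 0 ≤ p ω) {ω : X × Y} (hω : 0 < p ω) : 0 < arimotoSum α p := by
  have hn : ∀ y, 0 ≤ ∑ x, p (x, y) ^ α := fun y =>
    Finset.sum_nonneg fun x _ => Real.rpow_nonneg (hp _) _
  refine Finset.sum_pos' (fun y _ => Real.rpow_nonneg (hn y) _) ⟨ω.2, Finset.mem_univ _, ?_⟩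
  exact Real.rpow_pos_of_pos (Finset.sum_pos' (fun x _ => Real.rpow_nonneg (hp (x, ω.2)) _)
    ⟨ω.1, Finset.mem_univ _, Real.rpow_pos_of_pos hω α⟩) _

theorem IsPMF.exists_pos {Ω : Type*} [Fintype Ω] {p : Ω → ℝ} (hp : IsPMF p) : ∃ ω, 0 < p ω := by
  by_contra! h
  have := Finset.sum_nonpos fun ω (_ : ω ∈ Finset.univ) => h ω
  linarith [hp.2]

theorem rpow_rpow_one_div {α x : ℝ} (hα : 0 < α) (hx : 0 ≤ x) : (x ^ α) ^ (1 / α) = x := by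
  rw [← Real.rpow_mul hx, mul_one_div_cancel hα.ne', Real.rpow_one]

theorem IsPMF.arimotoSum_sub_one {Y : Type*} [Fintype Y] {p : ZMod 2 × Y → ℝ} (hp : IsPMF p)
    {α : ℝ} (hα : 0 < α) :
    arimotoSum α p - 1 = ∑ y, rpowGap (1 / α) (p (0, y) ^ α) (p (1, y) ^ α) := by
  have hs (f : ZMod 2 → ℝ) : ∑ x, f x = f 0 + f 1 := Fin.sum_univ_two f
  have h1 : ∑ y, ∑ x, p (x, y) = 1 := by rw [← Fintype.sum_prod_type_right, hp.2]
  rw [arimotoSum]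
  nth_rewrite 2 [← h1]
  rw [← Finset.sum_sub_distrib]
  refine Finset.sum_congr rfl fun y _ => ?_
  rw [hs, hs, rpowGap, rpow_rpow_one_div hα (hp.1 _), rpow_rpow_one_div hα (hp.1 _)]
  ring

theorem isPMF_combinedX2 {p1 : ZMod 2 × Y1 → ℝ}
    {p2 : ZMod 2 × Y2 → ℝ} (hp1 : IsPMF p1) (hp2 : IsPMF p2) : IsPMF (combinedX2 p1 p2) := by
  refine ⟨fun ω => mul_nonneg (hp1.1 _) (hp2.1 _), ?_⟩
  have h : ∀ x : ZMod 2, ∑ w : ZMod 2 × Y1 × Y2, combinedX2 p1 p2 (x, w) = ∑ y, p2 (x, y) := by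
    intro x
    calc ∑ w : ZMod 2 × Y1 × Y2, combinedX2 p1 p2 (x, w)
        = ∑ z : ZMod 2, ∑ y1, ∑ y2, p1 (z + x, y1) * p2 (x, y2) := by
          simp only [Fintype.sum_prod_type, combinedX2]
      _ = ∑ z : ZMod 2, ∑ y1, ∑ y2, p1 (z, y1) * p2 (x, y2) :=
          Equiv.sum_comp (Equiv.addRight x) fun z => ∑ y1, ∑ y2, p1 (z, y1) * p2 (x, y2)
      _ = (∑ ω, p1 ω) * ∑ y, p2 (x, y) := by
          simp only [← Finset.mul_sum, ← Finset.sum_mul, Fintype.sum_prod_type]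
      _ = _ := by rw [hp1.2, one_mul]
  rw [Fintype.sum_prod_type]
  simp only [h]
  rw [← hp2.2, Fintype.sum_prod_type]

theorem arimotoSum_combinedX2_sub_one
    {p1 : ZMod 2 × Y1 → ℝ} {p2 : ZMod 2 × Y2 → ℝ} (hp1 : IsPMF p1) (hp2 : IsPMF p2)
    {α : ℝ} (hα : 0 < α) :
    arimotoSum α (combinedX2 p1 p2) - 1 = ∑ y1, ∑ y2,
      (rpowGap (1 / α) (p1 (0, y1) ^ α * p2 (0, y2) ^ α) (p1 (1, y1) ^ α * p2 (1, y2) ^ α)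
        + rpowGap (1 / α) (p1 (1, y1) ^ α * p2 (0, y2) ^ α)
          (p1 (0, y1) ^ α * p2 (1, y2) ^ α)) := by
  have hs (f : ZMod 2 → ℝ) : ∑ x, f x = f 0 + f 1 := Fin.sum_univ_two f
  rw [(isPMF_combinedX2 hp1 hp2).arimotoSum_sub_one hα, Fintype.sum_prod_type, hs]
  simp only [Fintype.sum_prod_type, ← Finset.sum_add_distrib]
  refine Finset.sum_congr rfl fun y1 _ => Finset.sum_congr rfl fun y2 _ => ?_
  simp only [combinedX2, Real.mul_rpow (hp1.1 _) (hp2.1 _), add_zero, zero_add,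
    show (1 : ZMod 2) + 1 = 0 from rfl]

theorem sum_combineGap
    {p1 : ZMod 2 × Y1 → ℝ} {p2 : ZMod 2 × Y2 → ℝ} (hp1 : IsPMF p1) (hp2 : IsPMF p2)
    {α : ℝ} (hα : 0 < α) :
    ∑ y1, ∑ y2, combineGap (1 / α) (p1 (0, y1) ^ α) (p1 (1, y1) ^ α) (p2 (0, y2) ^ α)
      (p2 (1, y2) ^ α) = (2 ^ (1 / α) - 2) * (arimotoSum α (combinedX2 p1 p2) - 1)
        - 2 * ((arimotoSum α p1 - 1) * (arimotoSum α p2 - 1)) := by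
  rw [arimotoSum_combinedX2_sub_one hp1 hp2 hα, hp1.arimotoSum_sub_one hα,
    hp2.arimotoSum_sub_one hα, Finset.sum_mul_sum]
  simp only [combineGap, Finset.sum_sub_distrib, Finset.mul_sum]

theorem IsPMF.one_le_arimotoSum {Y : Type*} [Fintype Y] {p : ZMod 2 × Y → ℝ} (hp : IsPMF p)
    {α : ℝ} (hα : 0 < α) (hα1 : α ≤ 1) : 1 ≤ arimotoSum α p := by
  rw [← sub_nonneg, hp.arimotoSum_sub_one hα]
  refine Finset.sum_nonneg fun y _ => ?_
  have := Real.add_rpow_le_rpow_add (Real.rpow_nonneg (hp.1 (0, y)) α)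
    (Real.rpow_nonneg (hp.1 (1, y)) α) ((one_le_div hα).2 hα1)
  rw [rpowGap]
  linarith

theorem two_lt_two_rpow_one_div {α : ℝ} (hα : 0 < α) (hα1 : α < 1) :
    (2 : ℝ) < 2 ^ (1 / α) :=
  Real.self_lt_rpow_of_one_lt one_lt_two ((one_lt_div hα).2 hα1)

theorem two_rpow_one_div_lt_two {α : ℝ} (hα1 : 1 < α) : (2 : ℝ) ^ (1 / α) < 2 :=
  Real.rpow_lt_self_of_one_lt one_lt_two ((div_lt_one (by linarith)).2 hα1)

theorem two_rpow_one_div_sub_two_ne_zero {α : ℝ} (hα : 0 < α) (hα1 : α ≠ 1) :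
    (2 : ℝ) ^ (1 / α) - 2 ≠ 0 := by
  rcases hα1.lt_or_gt with h | h
  · exact (sub_pos.2 (two_lt_two_rpow_one_div hα h)).ne'
  · exact (sub_neg.2 (two_rpow_one_div_lt_two h)).ne

/-- The entropy obtained from the erasure-channel bound when the two inputs have
conditional entropies `h1` and `h2`. -/
noncomputable def becBound (α h1 h2 : ℝ) : ℝ :=
  h1 + h2 - (α / (α - 1)) * Real.log
    (((2:ℝ) ^ ((α - 1)/α) - Real.exp (((α - 1)/α) * h1)) *
      ((2:ℝ) ^ ((α - 1)/α) - Real.exp (((α - 1)/α) * h2)) /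
        (1 - (2:ℝ) ^ ((α - 1)/α)) + (2:ℝ) ^ ((α - 1)/α))

theorem becBound_eq_log {S1 S2 T α : ℝ} (hα : 0 < α) (hα1 : α ≠ 1) (hS1 : 0 < S1) (hS2 : 0 < S2)
    (hT : 0 < T) (hTe : (2 ^ (1 / α) - 2) * (T - 1) = 2 * ((S1 - 1) * (S2 - 1))) :
    becBound α ((α / (1 - α)) * Real.log S1) ((α / (1 - α)) * Real.log S2) =
      (α / (1 - α)) * Real.log T := by
  have h1 : 1 - α ≠ 0 := sub_ne_zero.2 hα1.symm
  have h2 : α - 1 ≠ 0 := sub_ne_zero.2 hα1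
  have hexp (S : ℝ) (hS : 0 < S) :
      Real.exp (((α - 1)/α) * ((α / (1 - α)) * Real.log S)) = S⁻¹ := by
    rw [← Real.exp_log (inv_pos.2 hS), Real.log_inv]
    congr 1
    field_simp
    ring
  have hδ : (2:ℝ) ^ ((α - 1)/α) = 2 / 2 ^ (1 / α) := by
    rw [sub_div, div_self hα.ne', Real.rpow_sub two_pos, Real.rpow_one]
  have hP0 : (0 : ℝ) < 2 ^ (1 / α) := Real.rpow_pos_of_pos two_pos _
  have hP := two_rpow_one_div_sub_two_ne_zero hα hα1
  rw [becBound, hexp S1 hS1, hexp S2 hS2, hδ]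
  generalize (2 : ℝ) ^ (1 / α) = P at *
  have harg : (2 / P - S1⁻¹) * (2 / P - S2⁻¹) / (1 - 2 / P) + 2 / P = T / (S1 * S2) := by
    have : 1 - 2 / P ≠ 0 := by
      rw [one_sub_div hP0.ne']
      exact div_ne_zero hP hP0.ne'
    rw [one_sub_div hP0.ne']
    field_simp
    linear_combination (-P) * hTe
  rw [harg, Real.log_div hT.ne' (mul_pos hS1 hS2).ne', Real.log_mul hS1.ne' hS2.ne',
    show α / (α - 1) = -(α / (1 - α)) by rw [← neg_sub 1 α, div_neg]]
  ring

theorem log_le_log_iff_two_rpow {S T α : ℝ} (hα : 0 < α) (hα1 : α ≠ 1) (hS : 0 < S)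
    (hT : 0 < T) : (α / (1 - α)) * Real.log T ≤ (α / (1 - α)) * Real.log S ↔
      (2 ^ (1 / α) - 2) * (T - 1) ≤ (2 ^ (1 / α) - 2) * (S - 1) := by
  rcases hα1.lt_or_gt with h | h
  · rw [mul_le_mul_iff_right₀ (div_pos hα (sub_pos.2 h)), Real.log_le_log_iff hT hS,
      mul_le_mul_iff_right₀ (sub_pos.2 (two_lt_two_rpow_one_div hα h)), sub_le_sub_iff_right]
  · rw [mul_le_mul_left_of_neg (div_neg_of_pos_of_neg hα (sub_neg.2 h)), Real.log_le_log_iff hS hT,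
      mul_le_mul_left_of_neg (sub_neg.2 (two_rpow_one_div_lt_two h)), sub_le_sub_iff_right]

/-- **Arimoto BEC-type lower bound for the variable node**
(Theorem on `H^A_α(X₂|X₁⊕X₂, Y₁Y₂)`). -/
theorem arimoto_bec_bound
    (p1 : ZMod 2 × Y1 → ℝ) (p2 : ZMod 2 × Y2 → ℝ) (hp1 : IsPMF p1) (hp2 : IsPMF p2)
    (α : ℝ) (hα0 : 0 < α) :
    (α ∈ Set.Ioc (0:ℝ) (1/3) ∪ Set.Ico (1/2:ℝ) 1 ∪ Set.Ioi (1:ℝ) →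
      HA α (combinedX2 p1 p2) ≥
        HA α p1 + HA α p2 - (α / (α - 1)) * Real.log
          (((2:ℝ) ^ ((α - 1)/α) - Real.exp (((α - 1)/α) * HA α p1)) *
            ((2:ℝ) ^ ((α - 1)/α) - Real.exp (((α - 1)/α) * HA α p2)) /
              (1 - (2:ℝ) ^ ((α - 1)/α)) + (2:ℝ) ^ ((α - 1)/α))) ∧
    (α ∈ Set.Icc (1/3:ℝ) (1/2) →
      HA α (combinedX2 p1 p2) ≤
        HA α p1 + HA α p2 - (α / (α - 1)) * Real.log
          (((2:ℝ) ^ ((α - 1)/α) - Real.exp (((α - 1)/α) * HA α p1)) *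
            ((2:ℝ) ^ ((α - 1)/α) - Real.exp (((α - 1)/α) * HA α p2)) /
              (1 - (2:ℝ) ^ ((α - 1)/α)) + (2:ℝ) ^ ((α - 1)/α))) ∧
    (α = 1/3 ∨ α = 1/2 →
      HA α (combinedX2 p1 p2) =
        HA α p1 + HA α p2 - (α / (α - 1)) * Real.log
          (((2:ℝ) ^ ((α - 1)/α) - Real.exp (((α - 1)/α) * HA α p1)) *
            ((2:ℝ) ^ ((α - 1)/α) - Real.exp (((α - 1)/α) * HA α p2)) /
              (1 - (2:ℝ) ^ ((α - 1)/α)) + (2:ℝ) ^ ((α - 1)/α))) := by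
  obtain ⟨ω1, hω1⟩ := hp1.exists_pos
  obtain ⟨ω2, hω2⟩ := hp2.exists_pos
  have hp12 := isPMF_combinedX2 hp1 hp2
  obtain ⟨ω, hω⟩ := hp12.exists_pos
  have hS1 := arimotoSum_pos α hp1.1 hω1
  have hS2 := arimotoSum_pos α hp2.1 hω2
  have hS := arimotoSum_pos α hp12.1 hω
  have hβ : 0 < 1 / α := one_div_pos.2 hα0
  have hk : (1 / α - 2) * (1 / α - 3) = (1 - 2 * α) * (1 - 3 * α) / α ^ 2 := by
    field_simp
  have hsum := sum_combineGap hp1 hp2 hα0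
  have nn1 (ω) : 0 ≤ p1 ω ^ α := Real.rpow_nonneg (hp1.1 ω) α
  have nn2 (ω) : 0 ≤ p2 ω ^ α := Real.rpow_nonneg (hp2.1 ω) α
  rw [HA_eq_log_arimotoSum hα0 hp1.1, HA_eq_log_arimotoSum hα0 hp2.1,
    HA_eq_log_arimotoSum hα0 hp12.1]
  have exists_target (hα1 : α ≠ 1) : ∃ T : ℝ,
      (2 ^ (1 / α) - 2) * (T - 1) = 2 * ((arimotoSum α p1 - 1) * (arimotoSum α p2 - 1)) ∧
      (α < 1 → 0 < T) := by
    have hP : (2 : ℝ) ^ (1 / α) - 2 ≠ 0 := two_rpow_one_div_sub_two_ne_zero hα0 hα1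
    refine ⟨1 + 2 * ((arimotoSum α p1 - 1) * (arimotoSum α p2 - 1)) / (2 ^ (1 / α) - 2),
      by rw [add_sub_cancel_left, mul_div_cancel₀ _ hP], fun h => ?_⟩
    have h1 := sub_nonneg.2 (hp1.one_le_arimotoSum hα0 h.le)
    have h2 := sub_nonneg.2 (hp2.one_le_arimotoSum hα0 h.le)
    have h3 := sub_pos.2 (two_lt_two_rpow_one_div hα0 h)
    positivity
  have lower (hα1 : α ≠ 1) (h : 0 ≤ (1 - 2 * α) * (1 - 3 * α)) :
      becBound α ((α / (1 - α)) * Real.log (arimotoSum α p1))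
        ((α / (1 - α)) * Real.log (arimotoSum α p2)) ≤
        (α / (1 - α)) * Real.log (arimotoSum α (combinedX2 p1 p2)) := by
    obtain ⟨T, hTe, hT⟩ := exists_target hα1
    have hle := Finset.sum_nonneg fun y1 (_ : y1 ∈ Finset.univ) =>
      Finset.sum_nonneg fun y2 (_ : y2 ∈ Finset.univ) =>
        combineGap_nonneg hβ (by rw [hk]; positivity) (nn1 (0, y1)) (nn1 (1, y1)) (nn2 (0, y2))
          (nn2 (1, y2))
    rw [hsum, ← hTe, sub_nonneg] at hle
    have hT : 0 < T := by
      rcases hα1.lt_or_gt with h | h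
      · exact hT h
      · rw [mul_le_mul_left_of_neg (sub_neg.2 (two_rpow_one_div_lt_two h))] at hle
        linarith
    exact (becBound_eq_log hα0 hα1 hS1 hS2 hT hTe).trans_le
      ((log_le_log_iff_two_rpow hα0 hα1 hS hT).2 hle)
  have upper (hα1 : α < 1) (h : (1 - 2 * α) * (1 - 3 * α) ≤ 0) :
      (α / (1 - α)) * Real.log (arimotoSum α (combinedX2 p1 p2)) ≤
      becBound α ((α / (1 - α)) * Real.log (arimotoSum α p1))
        ((α / (1 - α)) * Real.log (arimotoSum α p2)) := by
    obtain ⟨T, hTe, hT⟩ := exists_target hα1.ne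
    have hle := Finset.sum_nonpos fun y1 (_ : y1 ∈ Finset.univ) =>
      Finset.sum_nonpos fun y2 (_ : y2 ∈ Finset.univ) =>
        combineGap_nonpos hβ (by rw [hk]; exact div_nonpos_of_nonpos_of_nonneg h (sq_nonneg α))
          (nn1 (0, y1)) (nn1 (1, y1)) (nn2 (0, y2)) (nn2 (1, y2))
    rw [hsum, ← hTe, sub_nonpos] at hle
    exact ((log_le_log_iff_two_rpow hα0 hα1.ne (hT hα1) hS).2 hle).trans_eq
      (becBound_eq_log hα0 hα1.ne hS1 hS2 (hT hα1) hTe).symm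
  refine ⟨?_, ?_, ?_⟩
  · rintro ((⟨-, h⟩ | ⟨h, h1⟩) | h)
    · exact lower (by linarith) (by nlinarith)
    · exact lower h1.ne (by nlinarith)
    · rw [Set.mem_Ioi] at h
      exact lower h.ne' (by nlinarith)
  · rintro ⟨h, h'⟩
    exact upper (by linarith) (by nlinarith)
  · rintro (h | h)
    · exact le_antisymm (upper (by linarith) (by rw [h]; norm_num))
        (lower (by linarith) (by rw [h]; norm_num))
    · exact le_antisymm (upper (by linarith) (by rw [h]; norm_num))
        (lower (by linarith) (by rw [h]; norm_num))
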